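/- arXiv:0705.2278 — 4 statements merged into one kernel-verified Lean document; each statement's English description precedes it below -/
import Mathlib

section
/- Let (X, d) be a separable metric space with Borel probability measure μ, and let c > 0, t > 0, δ₀ ∈ (0, ∞] be such that μ(closed ball of radius δ around x) ≤ c·δᵗ for every x ∈ X and every δ ∈ (0, δ₀]. Let C ⊆ X be a nonempty finite set with |C| = K, and assume (cK)^{−1/t} ≤ δ₀. Then ∫_X min_{y ∈ C} d(x,y)² dμ(x) ≥ (t/(t+2)) · (cK)^{−2/t}. (This sphere-covering argument yields the lower bound of the distortion rate function: D*(K) ≥ (βp(n−q)/(βp(n−q)+2)) (c_{n,p,q,β} K)^{−2/(βp(n−q))} when specialized to the Grassmann manifold with its invariant measure and chordal distance, where t = βp(n−q).) -/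
open MeasureTheory
open scoped ENNReal

/-- The mass farther than `s` from a code `C` is at least one minus the mass allowed to `C.card`
balls of radius `s`. -/
theorem ofReal_one_sub_le_measure_lt_inf'_dist {X : Type*} [MetricSpace X]
    [MeasurableSpace X] [BorelSpace X] (μ : Measure X) [IsProbabilityMeasure μ]
    {s b : ℝ} (hb : 0 ≤ b) (C : Finset X) (hC : C.Nonempty)
    (hball : ∀ x : X, μ (Metric.closedBall x s) ≤ ENNReal.ofReal b) :
    ENNReal.ofReal (1 - C.card * b) ≤ μ {x | s < C.inf' hC fun y => dist x y} := by
  have hcover : {x | s < C.inf' hC fun y => dist x y} = (⋃ y ∈ C, Metric.closedBall y s)ᶜ := by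
    ext x
    simp [Finset.lt_inf'_iff]
  have hmeas : MeasurableSet (⋃ y ∈ C, Metric.closedBall y s) :=
    C.measurableSet_biUnion fun y _ => Metric.isClosed_closedBall.measurableSet
  rw [hcover, prob_compl_eq_one_sub hmeas, ENNReal.ofReal_sub _ (by positivity),
    ENNReal.ofReal_one]
  refine tsub_le_tsub_left ?_ _
  calc μ (⋃ y ∈ C, Metric.closedBall y s)
      ≤ ∑ y ∈ C, μ (Metric.closedBall y s) := measure_biUnion_finset_le _ _
    _ ≤ ∑ _y ∈ C, ENNReal.ofReal b := Finset.sum_le_sum fun y _ => hball y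
    _ = ENNReal.ofReal (C.card * b) := by
      rw [Finset.sum_const, nsmul_eq_mul, ENNReal.ofReal_mul (by positivity),
        ENNReal.ofReal_natCast]

theorem integral_one_sub_mul_rpow_mul {a t r : ℝ} (ht : 0 < t) (hr : 0 < r)
    (har : a * r ^ t = 1) :
    ∫ s in (0 : ℝ)..r, (1 - a * s ^ t) * s = t / (t + 2) * r ^ 2 / 2 := by
  have hcongr : ∀ s ∈ Set.uIcc 0 r, (1 - a * s ^ t) * s = s - a * s ^ (t + 1) := by
    intro s hs
    rw [Set.uIcc_of_le hr.le] at hs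
    rw [Real.rpow_add_one' hs.1 (by positivity)]
    ring
  rw [intervalIntegral.integral_congr hcongr, intervalIntegral.integral_sub
      intervalIntegral.intervalIntegrable_id
      ((intervalIntegral.intervalIntegrable_rpow' (by linarith)).const_mul a),
    intervalIntegral.integral_const_mul, integral_rpow (Or.inl (by linarith)), integral_id,
    Real.zero_rpow (by positivity), show t + 1 + 1 = t + (2 : ℕ) by push_cast; ring,
    Real.rpow_add_natCast hr.ne']
  have hmul : a * ((r ^ t * r ^ 2 - 0) / (t + (2 : ℕ))) = r ^ 2 / (t + 2) := by
    rw [sub_zero, mul_div_assoc', ← mul_assoc, har, one_mul]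
    norm_num
  rw [hmul]
  field_simp
  ring

/-- Sphere-covering lower bound on the distortion of a code: if `(X,d,μ)` is a separable
metric probability space in which every closed ball of radius `δ ∈ (0, δ₀]` has measure at
most `c δᵗ`, and `C` is a nonempty code of size `K` with `(cK)^{−1/t} ≤ δ₀`, then the average
squared distance to the nearest codeword is at least `(t/(t+2)) (cK)^{−2/t}`. -/
theorem stmt7 {X : Type*} [MetricSpace X] [TopologicalSpace.SeparableSpace X]
    [MeasurableSpace X] [BorelSpace X]
    (μ : Measure X) [IsProbabilityMeasure μ]
    (c t : ℝ) (hc : 0 < c) (ht : 0 < t) (δ₀ : ℝ≥0∞) (hδ₀ : 0 < δ₀)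
    (hball : ∀ x : X, ∀ δ : ℝ, 0 < δ → ENNReal.ofReal δ ≤ δ₀ →
      μ (Metric.closedBall x δ) ≤ ENNReal.ofReal (c * δ ^ t))
    (K : ℕ) (C : Finset X) (hC : C.Nonempty) (hcard : C.card = K)
    (hK : ENNReal.ofReal ((c * K) ^ (-(1 : ℝ) / t)) ≤ δ₀) :
    ENNReal.ofReal (t / (t + 2) * (c * K) ^ (-(2 : ℝ) / t))
      ≤ ∫⁻ x, ENNReal.ofReal ((C.inf' hC fun y => dist x y) ^ 2) ∂μ := by
  have hKpos : (0 : ℝ) < K := by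
    rw [← hcard]
    exact_mod_cast hC.card_pos
  have ha : 0 < c * K := by positivity
  set r : ℝ := (c * K) ^ (-(1 : ℝ) / t) with hr_def
  have hr : 0 < r := Real.rpow_pos_of_pos ha _
  have hrt : c * K * r ^ t = 1 := by
    rw [hr_def, ← Real.rpow_mul ha.le, div_mul_cancel₀ _ ht.ne', Real.rpow_neg_one,
      mul_inv_cancel₀ ha.ne']
  have hr2 : (c * K) ^ (-(2 : ℝ) / t) = r ^ 2 := by
    rw [hr_def, ← Real.rpow_natCast, ← Real.rpow_mul ha.le]
    congr 1
    push_cast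
    ring
  have hcont : Continuous fun x : X => C.inf' hC fun y => dist x y :=
    Continuous.finset_inf'_apply hC fun y _ => by fun_prop
  have hnonneg : ∀ x : X, 0 ≤ C.inf' hC fun y => dist x y := fun x =>
    Finset.le_inf' _ _ fun y _ => dist_nonneg
  have hlayer := lintegral_rpow_eq_lintegral_meas_lt_mul μ (p := 2)
    (Filter.Eventually.of_forall hnonneg) hcont.aemeasurable two_pos
  simp only [Real.rpow_two] at hlayer
  have hintegrable : IntervalIntegrable (fun s : ℝ => (1 - c * K * s ^ t) * s) volume 0 r := by
    refine Continuous.intervalIntegrable ?_ _ _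
    have := Real.continuous_rpow_const ht.le
    fun_prop
  have hle : ∀ s ∈ Set.Ioc 0 r, c * K * s ^ t ≤ 1 := fun s hs => by
    rw [← hrt]
    have := Real.rpow_le_rpow hs.1.le hs.2 ht.le
    gcongr
  have hrw : t / (t + 2) * r ^ 2 = 2 * ∫ s in Set.Ioc 0 r, (1 - c * K * s ^ t) * s := by
    rw [← intervalIntegral.integral_of_le hr.le, integral_one_sub_mul_rpow_mul ht hr hrt]
    ring
  rw [hlayer, hr2, hrw, ENNReal.ofReal_mul two_pos.le]
  gcongr
  rw [ofReal_integral_eq_lintegral_ofReal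
    ((intervalIntegrable_iff_integrableOn_Ioc_of_le hr.le).1 hintegrable)
    ((ae_restrict_iff' measurableSet_Ioc).2 (Filter.Eventually.of_forall fun s hs =>
      mul_nonneg (sub_nonneg.2 (hle s hs)) hs.1.le))]
  refine le_trans (setLIntegral_mono' measurableSet_Ioc fun s hs => ?_)
    (lintegral_mono_set Set.Ioc_subset_Ioi_self)
  rw [ENNReal.ofReal_mul (sub_nonneg.2 (hle s hs)), show (2 : ℝ) - 1 = 1 by norm_num,
    Real.rpow_one]
  gcongr
  have hs0 := hs.1
  have hmass := ofReal_one_sub_le_measure_lt_inf'_dist μ (s := s) (b := c * s ^ t)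
    (by positivity) C hC fun x =>
      hball x s hs.1 ((ENNReal.ofReal_le_ofReal hs.2).trans hK)
  rwa [hcard, ← mul_assoc, mul_comm (K : ℝ) c] at hmass
end

section
/- Let (X, d) be a separable metric space with Borel probability measure μ, and suppose d(x,y) ≤ d_max for all x, y ∈ X, and there are c > 0, t > 0, δ₀ ∈ (0, ∞) such that μ(closed ball of radius δ around x) ≥ c·δᵗ for every x ∈ X and every δ ∈ (0, δ₀]. Then for every integer K ≥ 1 there exists a set C ⊆ X with |C| ≤ K such that ∫_X min_{y ∈ C} d(x,y)² dμ(x) ≤ ∫₀^{δ₀²} (1 − c z^{t/2})^K dz + d_max² (1 − c δ₀ᵗ)^K. (This random-coding bound, obtained by averaging the distortion of a code of K points drawn i.i.d. from μ, underlies the upper bound of the distortion rate function D*(K) ≤ (2Γ(2/(βp(n−q)))/(βp(n−q))) (c_{n,p,q,β} K)^{−2/(βp(n−q))} (1+o(1)).) -/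
open MeasureTheory

/-- The distance from `x` to the nearest of the points `y i`. -/
noncomputable def nearestDist {X : Type*} [MetricSpace X] {K : ℕ} [NeZero K]
    (x : X) (y : Fin K → X) : ℝ :=
  Finset.univ.inf' Finset.univ_nonempty fun i => dist x (y i)

theorem continuous_nearestDist {X : Type*} [MetricSpace X] {K : ℕ} [NeZero K] :
    Continuous fun p : X × (Fin K → X) => nearestDist p.1 p.2 := by
  unfold nearestDist
  exact Continuous.finset_inf'_apply _ fun i _ => by fun_prop

theorem nearestDist_nonneg {X : Type*} [MetricSpace X] {K : ℕ} [NeZero K]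
    (x : X) (y : Fin K → X) : 0 ≤ nearestDist x y :=
  Finset.le_inf' _ _ fun _ _ => dist_nonneg

theorem nearestDist_le {X : Type*} [MetricSpace X] {K : ℕ} [NeZero K]
    (x : X) (y : Fin K → X) (i : Fin K) : nearestDist x y ≤ dist x (y i) :=
  Finset.inf'_le _ (Finset.mem_univ i)

/-- All `K` independent points miss the closed ball around `x` with the `K`-th power of the
probability that one of them does. -/
theorem pi_lt_nearestDist_sq {X : Type*} [MetricSpace X] [MeasurableSpace X] [BorelSpace X]
    (μ : Measure X) [IsProbabilityMeasure μ] {K : ℕ} [NeZero K] (x : X) (z : ℝ) (hz : 0 ≤ z) :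
    Measure.pi (fun _ : Fin K => μ) {y | z < nearestDist x y ^ 2} =
      (1 - μ (Metric.closedBall x (√z))) ^ K := by
  have h : {y : Fin K → X | z < nearestDist x y ^ 2} =
      Set.univ.pi fun _ => (Metric.closedBall x (√z))ᶜ := by
    ext y
    simp only [Set.mem_ofPred_eq, Set.mem_pi, Set.mem_univ, true_imp_iff, Set.mem_compl_iff,
      Metric.mem_closedBall, not_le]
    rw [← Real.sqrt_lt_sqrt_iff hz, Real.sqrt_sq (nearestDist_nonneg x y), nearestDist,
      Finset.lt_inf'_iff]
    simp [dist_comm]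
  rw [h, Measure.pi_pi, Finset.prod_const, Finset.card_univ, Fintype.card_fin,
    prob_compl_eq_one_sub Metric.isClosed_closedBall.measurableSet]

/-- The mean squared distance from `x` to the nearest of `K` independent points. -/
theorem lintegral_nearestDist_sq_le {X : Type*} [MetricSpace X]
    [TopologicalSpace.SeparableSpace X] [MeasurableSpace X] [BorelSpace X]
    (μ : Measure X) [IsProbabilityMeasure μ]
    (dmax : ℝ) (hdmax : ∀ x y : X, dist x y ≤ dmax)
    (c t δ₀ : ℝ) (ht : 0 < t) (hδ₀ : 0 < δ₀)
    (hball : ∀ x : X, ∀ δ : ℝ, 0 < δ → δ ≤ δ₀ →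
      ENNReal.ofReal (c * δ ^ t) ≤ μ (Metric.closedBall x δ))
    (K : ℕ) [NeZero K] (x : X) :
    ∫⁻ y, ENNReal.ofReal (nearestDist x y ^ 2) ∂Measure.pi (fun _ : Fin K => μ)
      ≤ ENNReal.ofReal
          ((∫ z in (0 : ℝ)..δ₀ ^ 2, (1 - c * z ^ (t / 2)) ^ K) +
            dmax ^ 2 * (1 - c * δ₀ ^ t) ^ K) := by
  have : SecondCountableTopology X := UniformSpace.secondCountable_of_separable X
  have hle : ∀ δ : ℝ, 0 < δ → δ ≤ δ₀ → 0 ≤ 1 - c * δ ^ t := fun δ h0 h1 => by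
    have := (hball x δ h0 h1).trans prob_le_one
    rw [ENNReal.ofReal_le_one] at this
    linarith
  have hmeas : ∀ δ : ℝ, 0 < δ → δ ≤ δ₀ →
      (1 - μ (Metric.closedBall x δ)) ^ K ≤ ENNReal.ofReal ((1 - c * δ ^ t) ^ K) := by
    intro δ h0 h1
    rw [ENNReal.ofReal_pow (hle δ h0 h1)]
    gcongr
    refine (tsub_le_tsub_left (hball x δ h0 h1) 1).trans ?_
    rw [tsub_le_iff_right]
    refine le_trans ?_ ENNReal.ofReal_add_le
    simp
  have hsqrt : ∀ z : ℝ, 0 ≤ z → √z ^ t = z ^ (t / 2) := fun z hz => by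
    rw [Real.sqrt_eq_rpow, ← Real.rpow_mul hz]
    ring_nf
  have hcont : Continuous fun y : Fin K → X => nearestDist x y :=
    continuous_nearestDist.comp (Continuous.prodMk_right x)
  have hA : ∀ z ∈ Set.Ioc 0 (δ₀ ^ 2), 0 ≤ (1 - c * z ^ (t / 2)) ^ K := fun z hz => by
    rw [← hsqrt z hz.1.le]
    exact pow_nonneg (hle _ (Real.sqrt_pos.2 hz.1) (Real.sqrt_le_iff.2 ⟨hδ₀.le, hz.2⟩)) K
  have hF : Continuous fun z : ℝ => (1 - c * z ^ (t / 2)) ^ K :=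
    (continuous_const.sub (continuous_const.mul
      (Real.continuous_rpow_const (by positivity)))).pow K
  have hB : 0 ≤ (1 - c * δ₀ ^ t) ^ K := pow_nonneg (hle δ₀ hδ₀ le_rfl) K
  rw [lintegral_eq_lintegral_meas_lt _ (Filter.Eventually.of_forall fun y => sq_nonneg _)
    (hcont.pow 2).measurable.aemeasurable]
  calc
    _ ≤ ∫⁻ z in Set.Ioi (0 : ℝ),
          ((Set.Ioc 0 (δ₀ ^ 2)).indicator
              (fun z => ENNReal.ofReal ((1 - c * z ^ (t / 2)) ^ K)) z +
            (Set.Ioc 0 (dmax ^ 2)).indicator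
              (fun _ => ENNReal.ofReal ((1 - c * δ₀ ^ t) ^ K)) z) := by
      refine setLIntegral_mono' measurableSet_Ioi fun z hz => ?_
      have hz : 0 < z := hz
      by_cases h1 : z ≤ δ₀ ^ 2
      · refine le_trans ?_ le_self_add
        rw [pi_lt_nearestDist_sq μ x z hz.le, Set.indicator_of_mem (Set.mem_Ioc.2 ⟨hz, h1⟩), ← hsqrt z hz.le]
        exact hmeas _ (Real.sqrt_pos.2 hz) (Real.sqrt_le_iff.2 ⟨hδ₀.le, h1⟩)
      · refine le_trans ?_ le_add_self
        by_cases h2 : z ≤ dmax ^ 2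
        · rw [pi_lt_nearestDist_sq μ x z hz.le, Set.indicator_of_mem (Set.mem_Ioc.2 ⟨hz, h2⟩)]
          refine le_trans ?_ (hmeas δ₀ hδ₀ le_rfl)
          gcongr
          exact Real.le_sqrt_of_sq_le (not_le.1 h1).le
        · have : {y : Fin K → X | z < nearestDist x y ^ 2} = ∅ := by
            refine Set.eq_empty_of_forall_notMem fun y hy => h2 ?_
            refine (le_of_lt hy).trans (pow_le_pow_left₀ (nearestDist_nonneg x y) ?_ 2)
            exact (nearestDist_le x y 0).trans (hdmax _ _)
          simp [this]
    _ ≤ ∫⁻ z, ((Set.Ioc 0 (δ₀ ^ 2)).indicator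
              (fun z => ENNReal.ofReal ((1 - c * z ^ (t / 2)) ^ K)) z +
            (Set.Ioc 0 (dmax ^ 2)).indicator
              (fun _ => ENNReal.ofReal ((1 - c * δ₀ ^ t) ^ K)) z) :=
      setLIntegral_le_lintegral _ _
    _ = _ := by
      rw [lintegral_add_right _ (measurable_const.indicator measurableSet_Ioc),
        lintegral_indicator measurableSet_Ioc, lintegral_indicator measurableSet_Ioc,
        setLIntegral_const, Real.volume_Ioc, sub_zero, ← ENNReal.ofReal_mul hB,
        intervalIntegral.integral_of_le (by positivity),
        ENNReal.ofReal_add (setIntegral_nonneg measurableSet_Ioc hA) (by positivity),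
        mul_comm (dmax ^ 2), ofReal_integral_eq_lintegral_ofReal
          (hF.integrableOn_Ioc) ((ae_restrict_iff' measurableSet_Ioc).2
            (Filter.Eventually.of_forall hA))]

/-- Random-coding upper bound on the distortion rate function: if `(X,d,μ)` is a separable
metric probability space, bounded by `d_max`, in which every closed ball of radius
`δ ∈ (0, δ₀]` has measure at least `c δᵗ`, then for every `K ≥ 1` there is a code `C` of size
at most `K` whose average squared distance to the nearest codeword is at most
`∫₀^{δ₀²} (1 − c z^{t/2})^K dz + d_max² (1 − c δ₀ᵗ)^K`. -/
theorem stmt8 {X : Type*} [MetricSpace X] [TopologicalSpace.SeparableSpace X]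
    [MeasurableSpace X] [BorelSpace X]
    (μ : Measure X) [IsProbabilityMeasure μ]
    (dmax : ℝ) (hdmax : ∀ x y : X, dist x y ≤ dmax)
    (c t δ₀ : ℝ) (hc : 0 < c) (ht : 0 < t) (hδ₀ : 0 < δ₀)
    (hball : ∀ x : X, ∀ δ : ℝ, 0 < δ → δ ≤ δ₀ →
      ENNReal.ofReal (c * δ ^ t) ≤ μ (Metric.closedBall x δ))
    (K : ℕ) (hK : 1 ≤ K) :
    ∃ (C : Finset X) (hC : C.Nonempty), C.card ≤ K ∧
      ∫⁻ x, ENNReal.ofReal ((C.inf' hC fun y => dist x y) ^ 2) ∂μ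
        ≤ ENNReal.ofReal
            ((∫ z in (0 : ℝ)..δ₀ ^ 2, (1 - c * z ^ (t / 2)) ^ K) +
              dmax ^ 2 * (1 - c * δ₀ ^ t) ^ K) := by
  have : NeZero K := ⟨by omega⟩
  have : SecondCountableTopology X := UniformSpace.secondCountable_of_separable X
  classical
  have hm : Measurable fun p : X × (Fin K → X) => ENNReal.ofReal (nearestDist p.1 p.2 ^ 2) :=
    (continuous_nearestDist.pow 2).measurable.ennreal_ofReal
  obtain ⟨y, hy⟩ := exists_le_lintegral (μ := Measure.pi fun _ : Fin K => μ)
    (f := fun y => ∫⁻ x, ENNReal.ofReal (nearestDist x y ^ 2) ∂μ)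
    hm.lintegral_prod_left.aemeasurable
  refine ⟨Finset.univ.image y, Finset.univ_nonempty.image y,
    Finset.card_image_le.trans (by simp), ?_⟩
  simp only [Finset.inf'_image]
  refine hy.trans ?_
  rw [lintegral_lintegral_swap (f := fun y x => ENNReal.ofReal (nearestDist x y ^ 2))
    (hm.comp measurable_swap).aemeasurable]
  refine (lintegral_mono fun x =>
    lintegral_nearestDist_sq_le μ dmax hdmax c t δ₀ ht hδ₀ hball K x).trans ?_
  simp
end

section
/- Fix integers 1 ≤ p ≤ q and β ∈ {1, 2}, and for n > p + q define c_{n,p,q,β} = (1 / Γ((β/2)·p·(n−q) + 1)) · Π_{i=1}^{p} [ Γ((β/2)(n−i+1)) / Γ((β/2)(q−i+1)) ]. Then lim_{n → ∞} (1/n) · log₂(1 / c_{n,p,q,β}) = (βp/2) · log₂(p). (This limit on the ball-volume constant is the key asymptotic ingredient in the proof that lim_{n→∞} (log₂ K*(D))/n = (βp/2) log₂(p/D).) -/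
open Filter
open scoped Topology

theorem tendsto_log_natCast_factorial_div_sub_log :
    Tendsto (fun n : ℕ => Real.log (n.factorial : ℝ) / n - Real.log n) atTop (𝓝 (-1)) := by
  have hlog : Tendsto (fun n : ℕ => Real.log (n : ℝ) / n) atTop (𝓝 0) :=
    Real.isLittleO_log_id_atTop.tendsto_div_nhds_zero.comp tendsto_natCast_atTop_atTop
  have hinv : Tendsto (fun n : ℕ => ((n : ℝ))⁻¹) atTop (𝓝 0) := tendsto_inv_atTop_nhds_zero_nat
  have hs : Tendsto (fun n : ℕ => Real.log (Stirling.stirlingSeq n)) atTop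
      (𝓝 (Real.log (√Real.pi))) :=
    Stirling.tendsto_stirlingSeq_sqrt_pi.log (by positivity)
  have h := ((hs.add_const (1 / 2 * Real.log 2)).mul hinv).add
    ((hlog.const_mul (1 / 2)).sub_const 1)
  refine (h.congr' ?_).trans (by simp)
  filter_upwards [eventually_gt_atTop 0] with n hn
  have hn' : (0 : ℝ) < n := by exact_mod_cast hn
  rw [Stirling.log_stirlingSeq_formula, Real.log_mul two_ne_zero hn'.ne',
    Real.log_div hn'.ne' (Real.exp_pos 1).ne', Real.log_exp]
  field_simp
  ring

theorem abs_log_Gamma_sub_log_factorial_floor_le {x : ℝ} (hx : 2 ≤ x) :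
    |Real.log (Real.Gamma x) - Real.log (⌊x⌋₊.factorial : ℝ)| ≤ Real.log x := by
  have hN : 2 ≤ ⌊x⌋₊ := Nat.le_floor (by exact_mod_cast hx)
  have hle : (⌊x⌋₊ : ℝ) ≤ x := Nat.floor_le (by linarith)
  have hlt : x < ⌊x⌋₊ + 1 := Nat.lt_floor_add_one x
  have hN' : (2 : ℝ) ≤ ⌊x⌋₊ := by exact_mod_cast hN
  generalize ⌊x⌋₊ = N at *
  have hmono := Real.Gamma_strictMonoOn_Ici.monotoneOn
  have hlow : Real.Gamma N ≤ Real.Gamma x := hmono hN' hx hle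
  have hup : Real.Gamma x ≤ Real.Gamma (N + 1) :=
    hmono hx (show (2 : ℝ) ≤ N + 1 by linarith) hlt.le
  have hpos : 0 < Real.Gamma x := Real.Gamma_pos_of_pos (by linarith)
  have hposN : 0 < Real.Gamma N := Real.Gamma_pos_of_pos (by linarith)
  have hfac : Real.log (N.factorial : ℝ) = Real.log N + Real.log (Real.Gamma N) := by
    rw [← Real.Gamma_nat_eq_factorial, Real.Gamma_add_one (by linarith),
      Real.log_mul (by linarith) hposN.ne']
  have h1 := Real.log_le_log hposN hlow
  have h2 := Real.log_le_log hpos hup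
  rw [Real.Gamma_nat_eq_factorial] at h2
  have h3 : Real.log N ≤ Real.log x := Real.log_le_log (by linarith) hle
  have h4 : 0 ≤ Real.log x := Real.log_nonneg (by linarith)
  rw [abs_le]
  constructor <;> linarith

theorem tendsto_log_Gamma_div_sub_log :
    Tendsto (fun x : ℝ => Real.log (Real.Gamma x) / x - Real.log x) atTop (𝓝 (-1)) := by
  have hlog : Tendsto (fun x : ℝ => Real.log x / x) atTop (𝓝 0) :=
    Real.isLittleO_log_id_atTop.tendsto_div_nhds_zero
  have hfloor : Tendsto (fun x : ℝ => (⌊x⌋₊ : ℝ) / x) atTop (𝓝 1) := tendsto_nat_floor_div_atTop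
  have hlogfloor : Tendsto (fun x : ℝ => Real.log ((⌊x⌋₊ : ℝ) / x)) atTop (𝓝 0) := by
    simpa using hfloor.log one_ne_zero
  have herr : Tendsto (fun x : ℝ =>
      (Real.log (Real.Gamma x) - Real.log (⌊x⌋₊.factorial : ℝ)) / x) atTop (𝓝 0) := by
    refine squeeze_zero_norm' ?_ hlog
    filter_upwards [eventually_ge_atTop 2] with x hx
    rw [Real.norm_eq_abs, abs_div, abs_of_pos (by linarith : 0 < x)]
    have := abs_log_Gamma_sub_log_factorial_floor_le hx
    gcongr
  have hround : Tendsto (fun x : ℝ => ((⌊x⌋₊ : ℝ) / x - 1) * Real.log x) atTop (𝓝 0) := by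
    refine squeeze_zero_norm' ?_ hlog
    filter_upwards [eventually_ge_atTop 2] with x hx
    have hx0 : 0 < x := by linarith
    have hle : (⌊x⌋₊ : ℝ) ≤ x := Nat.floor_le hx0.le
    have hlt : x < ⌊x⌋₊ + 1 := Nat.lt_floor_add_one x
    have h4 : 0 ≤ Real.log x := Real.log_nonneg (by linarith)
    have heq : ((⌊x⌋₊ : ℝ) / x - 1) * Real.log x = (⌊x⌋₊ - x) * (Real.log x / x) := by
      field_simp
    rw [heq, Real.norm_eq_abs, abs_mul, abs_of_nonneg (div_nonneg h4 hx0.le)]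
    refine mul_le_of_le_one_left (div_nonneg h4 hx0.le) ?_
    rw [abs_le]
    constructor <;> linarith
  have hfac := tendsto_log_natCast_factorial_div_sub_log.comp (tendsto_nat_floor_atTop (α := ℝ))
  have h := ((herr.add (hfloor.mul hfac)).add (hfloor.mul hlogfloor)).add hround
  refine (h.congr' ?_).trans (by simp)
  filter_upwards [eventually_ge_atTop 2] with x hx
  have hx0 : 0 < x := by linarith
  have hN : 2 ≤ ⌊x⌋₊ := Nat.le_floor (by exact_mod_cast hx)
  have hN0 : (0 : ℝ) < ⌊x⌋₊ := by exact_mod_cast (by omega : 0 < ⌊x⌋₊)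
  simp only [Function.comp]
  rw [Real.log_div hN0.ne' hx0.ne']
  field_simp
  ring

theorem tendsto_log_Gamma_mul_add_div_sub {c : ℝ} (hc : 0 < c) (d : ℝ) :
    Tendsto (fun n : ℕ => Real.log (Real.Gamma (c * n + d)) / n - c * Real.log n) atTop
      (𝓝 (c * Real.log c - c)) := by
  have hinv : Tendsto (fun n : ℕ => ((n : ℝ))⁻¹) atTop (𝓝 0) := tendsto_inv_atTop_nhds_zero_nat
  have htop : Tendsto (fun n : ℕ => c * (n : ℝ) + d) atTop atTop :=
    tendsto_atTop_add_const_right _ _ (tendsto_natCast_atTop_atTop.const_mul_atTop hc)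
  have hratio : Tendsto (fun n : ℕ => (c * (n : ℝ) + d) / n) atTop (𝓝 c) := by
    have h : Tendsto (fun n : ℕ => c + d * ((n : ℝ))⁻¹) atTop (𝓝 c) := by
      simpa using (hinv.const_mul d).const_add c
    refine h.congr' ?_
    filter_upwards [eventually_gt_atTop 0] with n hn
    have hn' : (0 : ℝ) < n := by exact_mod_cast hn
    field_simp
  have hlog : Tendsto (fun n : ℕ => Real.log (c * n + d) / (c * n + d)) atTop (𝓝 0) :=
    Real.isLittleO_log_id_atTop.tendsto_div_nhds_zero.comp htop
  have hG := tendsto_log_Gamma_div_sub_log.comp htop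
  have h := ((hratio.mul hG).add ((hratio.log hc.ne').const_mul c)).add
    ((hratio.mul hlog).const_mul d)
  refine (h.congr' ?_).trans (by
    rw [show c * -1 + c * Real.log c + d * (c * 0) = c * Real.log c - c by ring])
  filter_upwards [eventually_gt_atTop 0, htop.eventually_gt_atTop 0] with n hn hx
  have hn' : (0 : ℝ) < n := by exact_mod_cast hn
  simp only [Function.comp]
  rw [Real.log_div hx.ne' hn'.ne']
  generalize hy : c * (n : ℝ) + d = y at *
  obtain rfl : d = y - c * n := by linarith
  field_simp
  ring

/-- Asymptotics of the ball-volume constant `c_{n,p,q,β}` (branch `p + q ≤ n`):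
`(1/n) log₂(1/c_{n,p,q,β}) → (βp/2) log₂ p` as `n → ∞`. -/
theorem stmt16 (p q β : ℕ) (hp : 1 ≤ p) (hpq : p ≤ q) (hβ : β = 1 ∨ β = 2) :
    Tendsto
      (fun n : ℕ =>
        (1 / (n : ℝ)) *
          Real.logb 2
            (1 /
              ((1 / Real.Gamma ((β : ℝ) / 2 * p * ((n : ℝ) - q) + 1)) *
                ∏ i ∈ Finset.Icc 1 p,
                  Real.Gamma ((β : ℝ) / 2 * ((n : ℝ) - i + 1)) /
                    Real.Gamma ((β : ℝ) / 2 * ((q : ℝ) - i + 1)))))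
      atTop (𝓝 ((β : ℝ) * p / 2 * Real.logb 2 p)) := by
  have ha : (0 : ℝ) < (β : ℝ) / 2 := by rcases hβ with rfl | rfl <;> norm_num
  have hβa : (β : ℝ) * p / 2 = (β : ℝ) / 2 * p := by ring
  rw [hβa]
  generalize (β : ℝ) / 2 = a at *
  have hp0 : (0 : ℝ) < p := by exact_mod_cast hp
  have hinv : Tendsto (fun n : ℕ => ((n : ℝ))⁻¹) atTop (𝓝 0) := tendsto_inv_atTop_nhds_zero_nat
  have hnum := tendsto_log_Gamma_mul_add_div_sub (mul_pos ha hp0) (1 - a * p * q)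
  have hprod := tendsto_finsetSum (Finset.Icc 1 p) fun i _ =>
    tendsto_log_Gamma_mul_add_div_sub ha (a * (1 - (i : ℝ)))
  have hconst := hinv.const_mul
    (∑ i ∈ Finset.Icc 1 p, Real.log (Real.Gamma (a * ((q : ℝ) - i + 1))))
  have h := ((hnum.sub hprod).add hconst).div_const (Real.log 2)
  have hlim : (a * p * Real.log (a * p) - a * p -
      ∑ _i ∈ Finset.Icc 1 p, (a * Real.log a - a) +
      (∑ i ∈ Finset.Icc 1 p, Real.log (Real.Gamma (a * ((q : ℝ) - i + 1)))) * 0) / Real.log 2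
      = a * p * Real.logb 2 p := by
    rw [Real.log_mul ha.ne' hp0.ne', Finset.sum_const, Nat.card_Icc, Real.logb, nsmul_eq_mul,
      Nat.add_sub_cancel]
    ring
  rw [hlim] at h
  refine h.congr' ?_
  filter_upwards [eventually_gt_atTop q] with n hn
  have hqn : (q : ℝ) < n := by exact_mod_cast hn
  have hn0 : (n : ℝ) ≠ 0 := by
    have : (0 : ℝ) ≤ q := q.cast_nonneg
    linarith
  have hGp : Real.Gamma (a * p * ((n : ℝ) - q) + 1) ≠ 0 :=
    (Real.Gamma_pos_of_pos (add_pos (mul_pos (mul_pos ha hp0) (by linarith)) one_pos)).ne'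
  have hGq : ∀ i ∈ Finset.Icc 1 p, Real.Gamma (a * ((q : ℝ) - i + 1)) ≠ 0 := fun i hi => by
    have : (i : ℝ) ≤ q := by exact_mod_cast (Finset.mem_Icc.1 hi).2.trans hpq
    exact (Real.Gamma_pos_of_pos (mul_pos ha (by linarith))).ne'
  have hGn : ∀ i ∈ Finset.Icc 1 p, Real.Gamma (a * ((n : ℝ) - i + 1)) ≠ 0 := fun i hi => by
    have : (i : ℝ) ≤ q := by exact_mod_cast (Finset.mem_Icc.1 hi).2.trans hpq
    exact (Real.Gamma_pos_of_pos (mul_pos ha (by linarith))).ne'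
  have harg : a * p * (n : ℝ) + (1 - a * p * q) = a * p * ((n : ℝ) - q) + 1 := by ring
  have hargs : ∀ i : ℕ, a * (n : ℝ) + a * (1 - (i : ℝ)) = a * ((n : ℝ) - i + 1) := fun i => by
    ring
  rw [Real.logb, one_div_mul_eq_div, one_div_mul_eq_div, one_div_div, Real.log_div hGp
      (Finset.prod_ne_zero_iff.2 fun i hi => div_ne_zero (hGn i hi) (hGq i hi)),
    Real.log_prod fun i hi => div_ne_zero (hGn i hi) (hGq i hi),
    Finset.sum_congr rfl fun i hi => Real.log_div (hGn i hi) (hGq i hi)]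
  simp only [harg, hargs, Finset.sum_sub_distrib, Finset.sum_const, Nat.card_Icc,
    Nat.add_sub_cancel, nsmul_eq_mul, ← Finset.sum_div]
  field_simp
  ring
end

section
/- Fix integers 1 ≤ p ≤ q, β ∈ {1, 2}, and a real r̄ > 0, and for n > p + q define c_{n,p,q,β} = (1 / Γ((β/2)·p·(n−q) + 1)) · Π_{i=1}^{p} [ Γ((β/2)(n−i+1)) / Γ((β/2)(q−i+1)) ]. Let (K_n) be any sequence of positive integers with (log₂ K_n)/n → r̄ as n → ∞. Then lim_{n → ∞} (c_{n,p,q,β} · K_n)^{−2/(βp(n−q))} = p · 2^{−2r̄/(βp)}. (Since both the lower bound (t/(t+2))(cK)^{−2/t} and the upper bound (2Γ(2/t)/t)(cK)^{−2/t} on the distortion rate function, with t = βp(n−q), have the same limit, this identifies the asymptotic distortion rate tradeoff: lim D*(K_n) = p·2^{−2r̄/(βp)}.) -/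
open Filter
open scoped Topology

lemma Real.mul_log_sub_log_le {x y : ℝ} (hx : 0 < x) (hy : 0 < y) :
    x * (Real.log y - Real.log x) ≤ y - x := by
  rw [← Real.log_div hy.ne' hx.ne']
  calc x * Real.log (y / x) ≤ x * (y / x - 1) :=
        mul_le_mul_of_nonneg_left (Real.log_le_sub_one_of_pos (div_pos hy hx)) hx.le
    _ = y - x := by field_simp

/-- Elementary two-sided Stirling bound for the factorial. -/
lemma Nat.log_factorial_bounds (n : ℕ) (hn : 1 ≤ n) :
    (n : ℝ) * Real.log n - n ≤ Real.log (n.factorial) ∧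
      Real.log (n.factorial) ≤ (n : ℝ) * Real.log n - n + Real.log n + 1 := by
  induction n, hn using Nat.le_induction with
  | base => norm_num
  | succ n hn ih =>
    have hn0 : (0 : ℝ) < n := by exact_mod_cast hn
    have hlog : Real.log ((n + 1).factorial) = Real.log (n + 1) + Real.log n.factorial := by
      rw [Nat.factorial_succ, Nat.cast_mul, Real.log_mul (by positivity) (by positivity)]
      push_cast
      rfl
    have h1 := Real.mul_log_sub_log_le hn0 (by linarith : (0 : ℝ) < n + 1)
    have h2 := Real.mul_log_sub_log_le (by linarith : (0 : ℝ) < n + 1) hn0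
    rw [hlog]
    push_cast
    constructor <;> nlinarith [ih.1, ih.2]

/-- Elementary two-sided Stirling bound for the logarithm of the Gamma function. -/
lemma Real.abs_log_Gamma_sub_le {x : ℝ} (hx : 2 ≤ x) :
    |Real.log (Real.Gamma x) - (x * Real.log x - x)| ≤ 2 * Real.log x + 1 := by
  obtain ⟨m, hm, hmx, hxm⟩ : ∃ m : ℕ, 2 ≤ m ∧ (m : ℝ) ≤ x ∧ x < m + 1 :=
    ⟨⌊x⌋₊, Nat.le_floor (by exact_mod_cast hx), Nat.floor_le (by linarith), Nat.lt_floor_add_one x⟩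
  have hm2 : (2 : ℝ) ≤ m := by exact_mod_cast hm
  have hm0 : (0 : ℝ) < m := by linarith
  have hlm : 0 ≤ Real.log m := Real.log_nonneg (by linarith)
  have hlmx : Real.log m ≤ Real.log x := Real.log_le_log hm0 hmx
  have hmono := Real.Gamma_strictMonoOn_Ici.monotoneOn
  have hup : Real.log (Real.Gamma x) ≤ Real.log m.factorial := by
    rw [← Real.Gamma_nat_eq_factorial]
    exact Real.log_le_log (Real.Gamma_pos_of_pos (by linarith))
      (hmono hx (by simp only [Set.mem_Ici]; linarith) hxm.le)
  have hlow : Real.log m.factorial - Real.log m ≤ Real.log (Real.Gamma x) := by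
    rw [← Real.Gamma_nat_eq_factorial, Real.Gamma_add_one hm0.ne',
      Real.log_mul hm0.ne' (Real.Gamma_pos_of_pos hm0).ne', add_sub_cancel_left]
    exact Real.log_le_log (Real.Gamma_pos_of_pos hm0) (hmono hm2 hx hmx)
  obtain ⟨f1, f2⟩ := Nat.log_factorial_bounds m (by omega)
  have k1 := Real.mul_log_sub_log_le hm0 (by linarith : 0 < x)
  have k2 := Real.mul_log_sub_log_le (by linarith : 0 < x) hm0
  have e1 : 0 ≤ (x - m) * Real.log m := mul_nonneg (by linarith) hlm
  have e2 : (x - m) * Real.log x ≤ 1 * Real.log x :=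
    mul_le_mul_of_nonneg_right (by linarith) (by linarith)
  rw [abs_le]
  constructor <;> nlinarith

lemma tendsto_log_natCast_div_atTop :
    Tendsto (fun n : ℕ => Real.log n / n) atTop (𝓝 0) :=
  Real.isLittleO_log_id_atTop.tendsto_div_nhds_zero.comp tendsto_natCast_atTop_atTop

lemma tendsto_affine_div_natCast (a c : ℝ) :
    Tendsto (fun n : ℕ => (a * n + c) / n) atTop (𝓝 a) := by
  have h : Tendsto (fun n : ℕ => a + c / (n : ℝ)) atTop (𝓝 (a + 0)) :=
    tendsto_const_nhds.add (tendsto_const_div_atTop_nhds_zero_nat c)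
  rw [add_zero] at h
  refine h.congr' ?_
  filter_upwards [eventually_gt_atTop 0] with n hn
  have : (n : ℝ) ≠ 0 := by positivity
  field_simp

/-- First-order Stirling asymptotics of `log Γ` along an arithmetic progression. -/
lemma tendsto_log_Gamma_affine (a c : ℝ) (ha : 0 < a) :
    Tendsto (fun n : ℕ => Real.log (Real.Gamma (a * n + c)) / n - a * Real.log n) atTop
      (𝓝 (a * Real.log a - a)) := by
  have hy : Tendsto (fun n : ℕ => a * (n : ℝ) + c) atTop atTop :=
    tendsto_atTop_add_const_right _ _ (tendsto_natCast_atTop_atTop.const_mul_atTop ha)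
  have hyn := tendsto_affine_div_natCast a c
  have hlogy : Tendsto (fun n : ℕ => Real.log (a * n + c) / (a * n + c)) atTop (𝓝 0) :=
    Real.isLittleO_log_id_atTop.tendsto_div_nhds_zero.comp hy
  have hbound : Tendsto (fun n : ℕ => 2 * (Real.log (a * n + c) / (a * n + c) * ((a * n + c) / n))
      + 1 / (n : ℝ)) atTop (𝓝 0) := by
    simpa using ((hlogy.mul hyn).const_mul 2).add (tendsto_const_div_atTop_nhds_zero_nat (1 : ℝ))
  have herr : Tendsto (fun n : ℕ => (Real.log (Real.Gamma (a * n + c)) -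
      ((a * n + c) * Real.log (a * n + c) - (a * n + c))) / n) atTop (𝓝 0) := by
    refine squeeze_zero_norm' ?_ hbound
    filter_upwards [eventually_gt_atTop 0, hy.eventually_ge_atTop 2] with n hn h2
    have hn0 : (0 : ℝ) < n := by exact_mod_cast hn
    have hyne : a * (n : ℝ) + c ≠ 0 := by linarith
    rw [norm_div, Real.norm_eq_abs, Real.norm_of_nonneg hn0.le]
    calc _ ≤ (2 * Real.log (a * n + c) + 1) / n := by
          gcongr
          exact Real.abs_log_Gamma_sub_le h2
      _ = _ := by field_simp
  have hmain : Tendsto (fun n : ℕ => (a * n + c) / n * Real.log ((a * n + c) / n) +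
      c * (Real.log n / n) - (a * n + c) / n) atTop (𝓝 (a * Real.log a + c * 0 - a)) :=
    ((hyn.mul (hyn.log ha.ne')).add (tendsto_log_natCast_div_atTop.const_mul c)).sub hyn
  have hsum := herr.add hmain
  rw [mul_zero, add_zero, zero_add] at hsum
  refine hsum.congr' ?_
  filter_upwards [eventually_gt_atTop 0, hy.eventually_gt_atTop 0] with n hn hpos
  have hn0 : (n : ℝ) ≠ 0 := by positivity
  rw [Real.log_div hpos.ne' hn0]
  field_simp
  ring

/-- Asymptotic distortion rate tradeoff: if `(log₂ K_n)/n → r̄`, then with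
`c_{n,p,q,β}` the ball-volume constant (branch `p + q ≤ n`),
`(c_{n,p,q,β} K_n)^{−2/(βp(n−q))} → p · 2^{−2r̄/(βp)}` as `n → ∞`. -/
theorem stmt17 (p q β : ℕ) (hp : 1 ≤ p) (hpq : p ≤ q) (hβ : β = 1 ∨ β = 2)
    (r : ℝ) (hr : 0 < r) (K : ℕ → ℕ) (hKpos : ∀ n, 0 < K n)
    (hK : Tendsto (fun n : ℕ => Real.logb 2 (K n) / n) atTop (𝓝 r)) :
    Tendsto
      (fun n : ℕ =>
        (((1 / Real.Gamma ((β : ℝ) / 2 * p * ((n : ℝ) - q) + 1)) *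
            ∏ i ∈ Finset.Icc 1 p,
              Real.Gamma ((β : ℝ) / 2 * ((n : ℝ) - i + 1)) /
                Real.Gamma ((β : ℝ) / 2 * ((q : ℝ) - i + 1))) *
          (K n : ℝ)) ^ (-(2 : ℝ) / ((β : ℝ) * p * ((n : ℝ) - q))))
      atTop (𝓝 ((p : ℝ) * 2 ^ (-(2 : ℝ) * r / ((β : ℝ) * p)))) := by
  have hb : (0 : ℝ) < β := by rcases hβ with rfl | rfl <;> norm_num
  have hp0 : (0 : ℝ) < p := by exact_mod_cast hp
  have hl2 : Real.log 2 ≠ 0 := (Real.log_pos one_lt_two).ne'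
  have hprod : Tendsto (fun n : ℕ => ∑ i ∈ Finset.Icc 1 p,
      ((Real.log (Real.Gamma ((β : ℝ) / 2 * ((n : ℝ) - i + 1))) / n - β / 2 * Real.log n) -
        Real.log (Real.Gamma ((β : ℝ) / 2 * ((q : ℝ) - i + 1))) / n)) atTop
      (𝓝 (∑ i ∈ Finset.Icc 1 p, (((β : ℝ) / 2 * Real.log (β / 2) - β / 2) - 0))) := by
    refine tendsto_finsetSum _ fun i _ => ?_
    refine Tendsto.sub ?_ (tendsto_const_div_atTop_nhds_zero_nat _)
    refine (tendsto_log_Gamma_affine ((β : ℝ) / 2) (β / 2 * (1 - i)) (by positivity)).congr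
      fun n => ?_
    ring_nf
  have hball : Tendsto (fun n : ℕ =>
      Real.log (Real.Gamma ((β : ℝ) / 2 * p * ((n : ℝ) - q) + 1)) / n - β / 2 * p * Real.log n)
      atTop (𝓝 ((β : ℝ) / 2 * p * Real.log (β / 2 * p) - β / 2 * p)) := by
    refine (tendsto_log_Gamma_affine ((β : ℝ) / 2 * p) (1 - β / 2 * p * q) (by positivity)).congr
      fun n => ?_
    ring_nf
  have hexp : Tendsto (fun n : ℕ => -(2 : ℝ) / (β * p * (((n : ℝ) - q) / n))) atTop
      (𝓝 (-(2 : ℝ) / (β * p * 1))) := by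
    refine tendsto_const_nhds.div (Tendsto.const_mul _ ?_) (by positivity)
    simpa [sub_eq_add_neg] using tendsto_affine_div_natCast 1 (-(q : ℝ))
  have hlim := (((hprod.sub hball).add (hK.mul_const (Real.log 2))).mul hexp).rexp
  have hval : Real.exp ((∑ i ∈ Finset.Icc 1 p, (((β : ℝ) / 2 * Real.log (β / 2) - β / 2) - 0) -
      ((β : ℝ) / 2 * p * Real.log (β / 2 * p) - β / 2 * p) + r * Real.log 2) *
      (-(2 : ℝ) / (β * p * 1))) = (p : ℝ) * 2 ^ (-(2 : ℝ) * r / ((β : ℝ) * p)) := by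
    have hright : (p : ℝ) * 2 ^ (-(2 : ℝ) * r / ((β : ℝ) * p)) =
        Real.exp (Real.log p + Real.log 2 * (-(2 : ℝ) * r / ((β : ℝ) * p))) := by
      rw [Real.exp_add, Real.exp_log hp0, Real.rpow_def_of_pos two_pos]
    rw [hright, Real.log_mul (by positivity) hp0.ne', Finset.sum_const, Nat.card_Icc,
      nsmul_eq_mul, Nat.add_sub_cancel]
    congr 1
    field_simp
    ring
  rw [hval] at hlim
  refine hlim.congr' ?_
  filter_upwards [eventually_gt_atTop (p + q)] with n hn
  have hnq : (0 : ℝ) < (n : ℝ) - q := by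
    have : (q : ℝ) < n := by exact_mod_cast (by omega : q < n)
    linarith
  have hn0 : (0 : ℝ) < n := by exact_mod_cast (by omega : 0 < n)
  have hΓ : ∀ m : ℕ, p ≤ m → ∀ i ∈ Finset.Icc 1 p,
      0 < Real.Gamma ((β : ℝ) / 2 * ((m : ℝ) - i + 1)) := by
    intro m hm i hi
    have : (i : ℝ) ≤ m := by exact_mod_cast (Finset.mem_Icc.1 hi).2.trans hm
    exact Real.Gamma_pos_of_pos (mul_pos (by positivity) (by linarith))
  have hΓ0 : 0 < Real.Gamma ((β : ℝ) / 2 * p * ((n : ℝ) - q) + 1) :=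
    Real.Gamma_pos_of_pos (by positivity)
  have hfac : ∀ i ∈ Finset.Icc 1 p, 0 < Real.Gamma ((β : ℝ) / 2 * ((n : ℝ) - i + 1)) /
      Real.Gamma ((β : ℝ) / 2 * ((q : ℝ) - i + 1)) := fun i hi =>
    div_pos (hΓ n (by omega) i hi) (hΓ q hpq i hi)
  have hP := Finset.prod_pos hfac
  have hK0 : (0 : ℝ) < K n := by exact_mod_cast hKpos n
  have hsum : ∑ i ∈ Finset.Icc 1 p,
      ((Real.log (Real.Gamma ((β : ℝ) / 2 * ((n : ℝ) - i + 1))) / n - β / 2 * Real.log n) -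
        Real.log (Real.Gamma ((β : ℝ) / 2 * ((q : ℝ) - i + 1))) / n) =
      Real.log (∏ i ∈ Finset.Icc 1 p, Real.Gamma ((β : ℝ) / 2 * ((n : ℝ) - i + 1)) /
        Real.Gamma ((β : ℝ) / 2 * ((q : ℝ) - i + 1))) / n - p * (β / 2 * Real.log n) := by
    rw [Real.log_prod fun i hi => (hfac i hi).ne', Finset.sum_div]
    have hcard : (p : ℝ) * (β / 2 * Real.log n) =
        ∑ i ∈ Finset.Icc 1 p, (β : ℝ) / 2 * Real.log n := by
      rw [Finset.sum_const, Nat.card_Icc, nsmul_eq_mul, Nat.add_sub_cancel]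
    rw [hcard, ← Finset.sum_sub_distrib]
    refine Finset.sum_congr rfl fun i hi => ?_
    rw [Real.log_div (hΓ n (by omega) i hi).ne' (hΓ q hpq i hi).ne']
    ring
  rw [hsum, Real.rpow_def_of_pos (mul_pos (mul_pos (one_div_pos.2 hΓ0) hP) hK0),
    Real.log_mul (mul_pos (one_div_pos.2 hΓ0) hP).ne' hK0.ne',
    Real.log_mul (one_div_pos.2 hΓ0).ne' hP.ne', one_div, Real.log_inv, Real.logb]
  congr 1
  field_simp
  ring
end
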